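/- For every fixed integer k >= 0 there exists a polynomial P_k with rational coefficients such that (1-x)^2 * (sum over n >= 0 of a(n,k) x^n / n!) = P_k(x) as formal power series, and the limit c_k = lim as n tends to infinity of a(n,k)/(n * n!) exists and equals P_k(1). -/

import Mathlib

namespace BalancedTrees

/-- Plane binary trees with vertices labeled by natural numbers;
`nil` is the empty tree, and each child of a vertex is designated
as a left child or a right child. -/
inductive BT where
  | nil : BT
  | node (label : ℕ) (l r : BT) : BT
deriving DecidableEq

namespace BT

/-- `balRank t = some k` if and only if the root of `t` is a balanced vertex of
rank `k`, i.e. every descending path from the root to a leaf has length `k`. -/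
def balRank : BT → Option ℕ
  | .nil => none
  | .node _ .nil .nil => some 0
  | .node _ .nil (.node b rl rr) => (balRank (BT.node b rl rr)).map (· + 1)
  | .node _ (.node a ll lr) .nil => (balRank (BT.node a ll lr)).map (· + 1)
  | .node _ (.node a ll lr) (.node b rl rr) =>
      match balRank (BT.node a ll lr), balRank (BT.node b rl rr) with
      | some i, some j => if i = j then some (i + 1) else none
      | _, _ => none

/-- The number of balanced vertices of rank `k` in the tree `t`. -/
def countBal (k : ℕ) : BT → ℕ
  | .nil => 0
  | .node v l r =>
      countBal k l + countBal k r +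
        (if balRank (BT.node v l r) = some k then 1 else 0)

/-- The number of balanced vertices (of any rank) in the tree `t`. -/
def countBalAll : BT → ℕ
  | .nil => 0
  | .node v l r =>
      countBalAll l + countBalAll r +
        (if (balRank (BT.node v l r)).isSome then 1 else 0)

/-- Auxiliary, fuelled version of `treeOf`. -/
def treeOfAux : ℕ → List ℕ → BT
  | 0, _ => .nil
  | _ + 1, [] => .nil
  | fuel + 1, l =>
      let m := l.foldr max 0
      BT.node m (treeOfAux fuel (l.takeWhile (· != m)))
                (treeOfAux fuel ((l.dropWhile (· != m)).tail))

/-- The decreasing binary tree `T(π)` of a sequence `π` of distinct labels: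
the root is the maximum entry, and its left (resp. right) subtree is built
recursively from the part of the sequence to the left (resp. right) of the
maximum. This is a bijection between permutations of `{1,…,n}` and
decreasing binary trees on `{1,…,n}`. -/
def treeOf (l : List ℕ) : BT := treeOfAux l.length l

/-- Canonical form for non-plane 1-2 trees (as represented by plane trees):
an only child is stored as a left child, and of two (unordered) children the
one with the larger label is stored on the left. Decreasing binary trees in
canonical form are in bijection with non-plane 1-2 trees. -/
def canonNP : BT → Bool
  | .nil => true
  | .node _ l r =>
      canonNP l && canonNP r &&
        (match l, r with
         | .nil, .nil => true
         | .node _ _ _, .nil => true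
         | .nil, .node _ _ _ => false
         | .node a _ _, .node b _ _ => decide (b < a))

/-- Canonical form for plane 1-2 trees: an only child is stored as a left
child (an only child carries no left/right designation), while two children
remain ordered. Decreasing binary trees in canonical form are in bijection
with plane 1-2 trees. -/
def canonP : BT → Bool
  | .nil => true
  | .node _ l r =>
      canonP l && canonP r &&
        (match l, r with
         | .nil, .node _ _ _ => false
         | _, _ => true)

end BT

open BT

/-- The list of all permutations of `{1,…,n}`, each written as a list. -/
def perms (n : ℕ) : List (List ℕ) := (List.range' 1 n).permutations

/-- `a n k`: the total number of balanced vertices of rank `k` over all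
decreasing binary trees on `{1,…,n}`. -/
def a (n k : ℕ) : ℕ := ((perms n).map fun l => countBal k (treeOf l)).sum

/-- `r n k`: the number of decreasing binary trees on `{1,…,n}` whose root is
balanced of rank `k`. -/
def r (n k : ℕ) : ℕ :=
  ((perms n).filter fun l => decide (balRank (treeOf l) = some k)).length

/-- `p n k`: the probability that the root of a uniformly random decreasing
binary tree on `{1,…,n}` is balanced of rank `k`; by convention `p 0 k = 1`. -/
def p (n k : ℕ) : ℚ := if n = 0 then 1 else (r n k : ℚ) / (Nat.factorial n : ℚ)

/-- The number of decreasing binary trees on `{1,…,n}` whose root is balanced. -/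
def rootBal (n : ℕ) : ℕ :=
  ((perms n).filter fun l => (balRank (treeOf l)).isSome).length

/-- `proot n`: the probability that the root of a uniformly random decreasing
binary tree on `{1,…,n}` is balanced. -/
def proot (n : ℕ) : ℚ := (rootBal n : ℚ) / (Nat.factorial n : ℚ)

/-- The total number of balanced vertices over all decreasing binary trees
on `{1,…,n}`. -/
def totalBal (n : ℕ) : ℕ := ((perms n).map fun l => countBalAll (treeOf l)).sum

/-- `Pbal n`: the probability that a vertex chosen uniformly at random from
the `n * n!` vertices of all decreasing binary trees on `{1,…,n}` is balanced. -/
def Pbal (n : ℕ) : ℚ := (totalBal n : ℚ) / ((n : ℚ) * (Nat.factorial n : ℚ))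

/-- Permutations whose decreasing binary tree is a canonical representative
of a non-plane 1-2 tree; these are in bijection with non-plane 1-2 trees
on `{1,…,n}`. -/
def npPerms (n : ℕ) : List (List ℕ) := (perms n).filter fun l => canonNP (treeOf l)

/-- `E n`: the number of non-plane 1-2 trees on `{1,…,n}` (the Euler number). -/
def E (n : ℕ) : ℕ := (npPerms n).length

/-- `b n k`: the total number of balanced vertices of rank `k` over all
non-plane 1-2 trees on `{1,…,n}`. -/
def b (n k : ℕ) : ℕ := ((npPerms n).map fun l => countBal k (treeOf l)).sum

/-- `s n k`: the number of non-plane 1-2 trees on `{1,…,n}` whose root is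
balanced of rank `k`. -/
def s (n k : ℕ) : ℕ :=
  ((npPerms n).filter fun l => decide (balRank (treeOf l) = some k)).length

/-- Permutations whose decreasing binary tree is a canonical representative
of a plane 1-2 tree; these are in bijection with plane 1-2 trees on `{1,…,n}`. -/
def pPerms (n : ℕ) : List (List ℕ) := (perms n).filter fun l => canonP (treeOf l)

/-- `z n`: the number of plane 1-2 trees on `{1,…,n}`. -/
def z (n : ℕ) : ℕ := (pPerms n).length

/-- `d n k`: the total number of balanced vertices of rank `k` over all
plane 1-2 trees on `{1,…,n}`. -/
def d (n k : ℕ) : ℕ := ((pPerms n).map fun l => countBal k (treeOf l)).sum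

/-- `t n k`: the number of plane 1-2 trees on `{1,…,n}` whose root is
balanced of rank `k`. -/
def t (n k : ℕ) : ℕ :=
  ((pPerms n).filter fun l => decide (balRank (treeOf l) = some k)).length

end BalancedTrees

open BalancedTrees

namespace BalancedTrees

open BT

lemma foldr_max_eq {l : List ℕ} {m : ℕ} (hm : m ∈ l) (h : ∀ x ∈ l, x ≤ m) :
    l.foldr max 0 = m := by
  refine le_antisymm ?_ (List.le_max_of_le hm le_rfl)
  clear hm
  induction l with
  | nil => exact m.zero_le
  | cons x l ih =>
    exact max_le (h x (by simp)) (ih fun y hy => h y (List.mem_cons_of_mem _ hy))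

lemma foldr_max_mem {l : List ℕ} (hl : l ≠ []) : l.foldr max 0 ∈ l := by
  induction l with
  | nil => exact absurd rfl hl
  | cons x l ih =>
    rcases eq_or_ne l [] with rfl | h
    · simp
    · rcases max_choice x (l.foldr max 0) with hx | hx
      · simp [hx]
      · rw [List.foldr_cons, hx]
        exact List.mem_cons_of_mem _ (ih h)

/-- Induction on a duplicate-free list by splitting it at its maximum. -/
lemma nodup_split_max_induction {motive : (l : List ℕ) → l.Nodup → Prop}
    (nil : motive [] List.nodup_nil)
    (split : ∀ (m : ℕ) (l₁ l₂ : List ℕ), (∀ x ∈ l₁, x < m) → (∀ x ∈ l₂, x < m) →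
      ∀ (n₁ : l₁.Nodup) (n₂ : l₂.Nodup) (n : (l₁ ++ m :: l₂).Nodup),
      motive l₁ n₁ → motive l₂ n₂ → motive (l₁ ++ m :: l₂) n)
    (l : List ℕ) (hl : l.Nodup) : motive l hl := by
  induction hn : l.length using Nat.strong_induction_on generalizing l with
  | _ n ih =>
    subst hn
    rcases eq_or_ne l [] with rfl | hne
    · exact nil
    have hle : ∀ x ∈ l, x ≤ l.foldr max 0 := fun x hx => List.le_max_of_le hx le_rfl
    have hmem := foldr_max_mem hne
    generalize l.foldr max 0 = m at hle hmem
    obtain ⟨l₁, l₂, rfl⟩ := List.append_of_mem hmem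
    obtain ⟨h₁, h₂, h₁₂⟩ := List.nodup_append.1 hl
    obtain ⟨hm₂, h₂⟩ := List.nodup_cons.1 h₂
    refine split m l₁ l₂ (fun x hx => ?_) (fun x hx => ?_) h₁ h₂ hl
      (ih _ (by simp) l₁ h₁ rfl) (ih _ (by simp; omega) l₂ h₂ rfl)
    · exact lt_of_le_of_ne (hle x (by simp [hx])) (h₁₂ x hx m (by simp))
    · exact lt_of_le_of_ne (hle x (by simp [hx])) (fun h => hm₂ (h ▸ hx))

lemma treeOfAux_split (f m : ℕ) (l₁ l₂ : List ℕ) (h₁ : ∀ x ∈ l₁, x < m)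
    (h₂ : ∀ x ∈ l₂, x < m) :
    treeOfAux (f + 1) (l₁ ++ m :: l₂) =
      BT.node m (treeOfAux f l₁) (treeOfAux f l₂) := by
  have hmax : (l₁ ++ m :: l₂).foldr max 0 = m := by
    refine foldr_max_eq (by simp) fun x hx => ?_
    rcases List.mem_append.1 hx with hx | hx
    · exact (h₁ x hx).le
    · rcases List.mem_cons.1 hx with rfl | hx
      · exact le_rfl
      · exact (h₂ x hx).le
  have hp : ∀ x ∈ l₁, (x != m) = true := fun x hx => by simpa using (h₁ x hx).ne
  rw [treeOfAux, hmax]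
  · simp only [List.takeWhile_append_of_pos hp, List.dropWhile_append_of_pos hp]
    simp
  · simp

lemma treeOfAux_eq_treeOf (l : List ℕ) (hl : l.Nodup) :
    ∀ f, l.length ≤ f → treeOfAux f l = treeOf l := by
  induction l, hl using nodup_split_max_induction with
  | nil => intro f _; cases f <;> simp [treeOf, treeOfAux]
  | split m l₁ l₂ h₁ h₂ _ _ _ ih₁ ih₂ =>
    have key : ∀ f, (l₁ ++ m :: l₂).length ≤ f →
        treeOfAux f (l₁ ++ m :: l₂) = BT.node m (treeOf l₁) (treeOf l₂) := by
      intro f hf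
      simp only [List.length_append, List.length_cons] at hf
      obtain ⟨f, rfl⟩ : ∃ g, f = g + 1 := ⟨f - 1, by omega⟩
      rw [treeOfAux_split f m l₁ l₂ h₁ h₂, ih₁ f (by omega), ih₂ f (by omega)]
    intro f hf
    exact (key f hf).trans (key _ le_rfl).symm

lemma treeOf_split (m : ℕ) (l₁ l₂ : List ℕ) (h₁ : ∀ x ∈ l₁, x < m)
    (h₂ : ∀ x ∈ l₂, x < m) (n₁ : l₁.Nodup) (n₂ : l₂.Nodup) :
    treeOf (l₁ ++ m :: l₂) = BT.node m (treeOf l₁) (treeOf l₂) := by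
  have hlen : (l₁ ++ m :: l₂).length = (l₁.length + l₂.length) + 1 := by simp; omega
  rw [treeOf, hlen, treeOfAux_split _ m l₁ l₂ h₁ h₂,
    treeOfAux_eq_treeOf l₁ n₁ _ (by omega), treeOfAux_eq_treeOf l₂ n₂ _ (by omega)]

namespace BT

/-- Apply a map to every label of a tree. -/
def map (φ : ℕ → ℕ) : BT → BT
  | .nil => .nil
  | .node v l r => .node (φ v) (map φ l) (map φ r)

/-- The number of vertices of a tree. -/
def size : BT → ℕ
  | .nil => 0
  | .node _ l r => size l + size r + 1

lemma balRank_map (φ : ℕ → ℕ) (t : BT) : balRank (t.map φ) = balRank t := by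
  induction t with
  | nil => rfl
  | node v l r ihl ihr =>
    cases l <;> cases r <;> simp_all [map, balRank]

lemma countBal_map (k : ℕ) (φ : ℕ → ℕ) (t : BT) : countBal k (t.map φ) = countBal k t := by
  induction t with
  | nil => rfl
  | node v l r ihl ihr =>
    have h := balRank_map φ (.node v l r)
    simp only [map] at h
    simp [map, countBal, ihl, ihr, h]

lemma size_lt_of_balRank_eq_some {t : BT} {k : ℕ} (h : balRank t = some k) :
    t.size < 2 ^ (k + 1) := by
  induction t generalizing k with
  | nil => simp [balRank] at h
  | node v l r ihl ihr =>
    cases l with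
    | nil =>
      cases r with
      | nil => simp [size]
      | node b rl rr =>
        simp only [balRank, Option.map_eq_some_iff] at h
        obtain ⟨j, hj, rfl⟩ := h
        have := ihr hj
        simp only [size] at this ⊢
        rw [pow_succ]
        omega
    | node a ll lr =>
      cases r with
      | nil =>
        simp only [balRank, Option.map_eq_some_iff] at h
        obtain ⟨j, hj, rfl⟩ := h
        have := ihl hj
        simp only [size] at this ⊢
        rw [pow_succ]
        omega
      | node b rl rr =>
        simp only [balRank] at h
        split at h
        · rename_i i j hi hj
          split_ifs at h with hij
          subst hij
          obtain rfl : i + 1 = k := by simpa using h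
          have h₁ := ihl hi
          have h₂ := ihr hj
          simp only [size] at h₁ h₂ ⊢
          rw [pow_succ]
          omega
        · simp at h

end BT

lemma size_treeOf (l : List ℕ) (hl : l.Nodup) : (treeOf l).size = l.length := by
  induction l, hl using nodup_split_max_induction with
  | nil => rfl
  | split m l₁ l₂ h₁ h₂ n₁ n₂ _ ih₁ ih₂ =>
    rw [treeOf_split m l₁ l₂ h₁ h₂ n₁ n₂, BT.size, ih₁, ih₂]
    simp
    omega

lemma treeOf_map {φ : ℕ → ℕ} (hφ : StrictMono φ) (l : List ℕ) (hl : l.Nodup) :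
    treeOf (l.map φ) = (treeOf l).map φ := by
  induction l, hl using nodup_split_max_induction with
  | nil => rfl
  | split m l₁ l₂ h₁ h₂ n₁ n₂ _ ih₁ ih₂ =>
    rw [treeOf_split m l₁ l₂ h₁ h₂ n₁ n₂, List.map_append, List.map_cons,
      treeOf_split (φ m) _ _ _ _ (n₁.map hφ.injective) (n₂.map hφ.injective), ih₁, ih₂, BT.map]
    · simpa using fun x hx => hφ (h₁ x hx)
    · simpa using fun x hx => hφ (h₂ x hx)

/-- The finset of all arrangements of the elements of `S` in a list. -/
noncomputable def arrangements (S : Finset ℕ) : Finset (List ℕ) :=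
  S.toList.permutations.toFinset

lemma mem_arrangements {S : Finset ℕ} {l : List ℕ} :
    l ∈ arrangements S ↔ l.Nodup ∧ l.toFinset = S := by
  rw [arrangements, List.mem_toFinset, List.mem_permutations]
  constructor
  · intro h
    refine ⟨h.nodup_iff.2 S.nodup_toList, ?_⟩
    rw [List.toFinset_eq_of_perm _ _ h, Finset.toList_toFinset]
  · rintro ⟨h, rfl⟩
    exact (List.perm_ext_iff_of_nodup h (Finset.nodup_toList _)).2 (by simp)

lemma card_arrangements (S : Finset ℕ) : (arrangements S).card = S.card.factorial := by
  rw [arrangements, List.toFinset_card_of_nodup (List.nodup_permutations _ S.nodup_toList),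
    List.length_permutations, Finset.length_toList]

lemma sum_arrangements_insert (M : ℕ) (T : Finset ℕ) (hM : M ∉ T) (F : List ℕ → ℕ) :
    ∑ l ∈ arrangements (insert M T), F l =
      ∑ A ∈ T.powerset, ∑ q ∈ arrangements A ×ˢ arrangements (T \ A),
        F (q.1 ++ M :: q.2) := by
  rw [Finset.sum_sigma']
  symm
  refine Finset.sum_bij (fun x _ => x.2.1 ++ M :: x.2.2) ?_ ?_ ?_ (fun _ _ => rfl)
  · rintro ⟨A, l₁, l₂⟩ h
    simp only [Finset.mem_sigma, Finset.mem_powerset, Finset.mem_product,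
      mem_arrangements] at h
    obtain ⟨hA, ⟨n₁, e₁⟩, n₂, e₂⟩ := h
    have m₁ : ∀ x, x ∈ l₁ ↔ x ∈ A := fun x => by rw [← e₁]; simp
    have m₂ : ∀ x, x ∈ l₂ ↔ x ∈ T ∧ x ∉ A := fun x => by
      rw [← Finset.mem_sdiff, ← e₂]; simp
    rw [mem_arrangements, List.nodup_append, List.nodup_cons]
    refine ⟨⟨n₁, ⟨fun h => hM ((m₂ M).1 h).1, n₂⟩, ?_⟩, ?_⟩
    · rintro x hx y hy rfl
      rw [m₁] at hx
      rcases List.mem_cons.1 hy with rfl | hy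
      · exact hM (hA hx)
      · exact ((m₂ x).1 hy).2 hx
    · ext x
      simp only [List.mem_toFinset, List.mem_append, List.mem_cons, m₁, m₂, Finset.mem_insert]
      have := @hA x
      tauto
  · rintro ⟨A, l₁, l₂⟩ h ⟨A', l₁', l₂'⟩ h' heq
    simp only [Finset.mem_sigma, Finset.mem_powerset, Finset.mem_product,
      mem_arrangements] at h h'
    obtain ⟨hA, ⟨n₁, rfl⟩, n₂, e₂⟩ := h
    obtain ⟨hA', ⟨n₁', rfl⟩, n₂', e₂'⟩ := h'
    have hM₁ : M ∉ l₁ := fun h => hM (hA (by simpa using h))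
    have hM₂ : M ∉ l₂ := fun h => hM (by
      have : M ∈ l₂.toFinset := by simpa using h
      rw [e₂] at this
      exact (Finset.mem_sdiff.1 this).1)
    obtain ⟨rfl, -, rfl⟩ := (List.append_cons_inj_of_notMem hM₁ hM₂).1 heq
    rfl
  · intro l hl
    obtain ⟨hn, he⟩ := mem_arrangements.1 hl
    have hMl : M ∈ l := by
      have : M ∈ l.toFinset := by rw [he]; simp
      simpa using this
    obtain ⟨l₁, l₂, rfl⟩ := List.append_of_mem hMl
    obtain ⟨n₁, n₂, h₁₂⟩ := List.nodup_append.1 hn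
    obtain ⟨hM₂, n₂⟩ := List.nodup_cons.1 n₂
    have hmem : ∀ x, x ∈ l₁ ∨ x = M ∨ x ∈ l₂ ↔ x = M ∨ x ∈ T := fun x => by
      rw [← Finset.mem_insert, ← he, List.mem_toFinset, List.mem_append, List.mem_cons]
    have hM₁ : M ∉ l₁ := fun h => h₁₂ M h M (by simp) rfl
    have hd : ∀ x ∈ l₁, x ∉ l₂ := fun x hx hx' => h₁₂ x hx x (by simp [hx']) rfl
    refine ⟨⟨l₁.toFinset, l₁, l₂⟩, ?_, rfl⟩
    simp only [Finset.mem_sigma, Finset.mem_powerset, Finset.mem_product, mem_arrangements]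
    refine ⟨fun x hx => ?_, ⟨n₁, trivial⟩, n₂, ?_⟩
    · rw [List.mem_toFinset] at hx
      exact ((hmem x).1 (Or.inl hx)).resolve_left (fun h => hM₁ (h ▸ hx))
    · ext x
      simp only [List.mem_toFinset, Finset.mem_sdiff]
      have := hmem x
      have := hd x
      by_cases hx : x = M
      · subst hx; tauto
      · tauto

lemma a_eq_sum_arrangements_range' (n k : ℕ) :
    a n k = ∑ l ∈ arrangements (List.range' 1 n).toFinset, countBal k (treeOf l) := by
  have hnd : (List.range' 1 n).Nodup := List.nodup_range'
  rw [a, perms, ← List.sum_toFinset _ (List.nodup_permutations _ hnd)]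
  refine Finset.sum_congr ?_ fun _ _ => rfl
  ext l
  rw [mem_arrangements, List.mem_toFinset, List.mem_permutations]
  constructor
  · exact fun h => ⟨h.nodup_iff.2 hnd, List.toFinset_eq_of_perm _ _ h⟩
  · rintro ⟨h, e⟩
    exact List.perm_of_nodup_nodup_toFinset_eq h hnd e

lemma exists_strictMono_image_range (S : Finset ℕ) :
    ∃ φ : ℕ → ℕ, StrictMono φ ∧ (Finset.range S.card).image φ = S := by
  induction S using Finset.induction_on_max with
  | empty => exact ⟨id, strictMono_id, by simp⟩
  | insert M S hS ih =>
    obtain ⟨φ, hφ, hS'⟩ := ih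
    have hlt : ∀ i < S.card, φ i < M := fun i hi => hS _ (by
      rw [← hS']
      exact Finset.mem_image_of_mem _ (Finset.mem_range.2 hi))
    refine ⟨fun i => if i < S.card then φ i else M + (i - S.card), ?_, ?_⟩
    · intro i j hij
      dsimp only
      split_ifs with h₁ h₂
      · exact hφ hij
      · have := hlt i h₁
        omega
      · omega
      · omega
    · rw [Finset.card_insert_of_notMem fun h => (hS M h).false, Finset.range_add_one,
        Finset.image_insert]
      have himg : (Finset.range S.card).image
          (fun i => if i < S.card then φ i else M + (i - S.card)) = S := by
        conv_rhs => rw [← hS']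
        exact Finset.image_congr fun i hi => by
          simp [Finset.mem_range.1 (Finset.mem_coe.1 hi)]
      rw [himg]
      simp

lemma sum_countBal_image (k : ℕ) {φ : ℕ → ℕ} (hφ : StrictMono φ) (S : Finset ℕ) :
    ∑ l ∈ arrangements (S.image φ), countBal k (treeOf l) =
      ∑ l ∈ arrangements S, countBal k (treeOf l) := by
  have himg : arrangements (S.image φ) = (arrangements S).image (List.map φ) := by
    symm
    refine Finset.eq_of_subset_of_card_le ?_ ?_
    · intro l hl
      obtain ⟨l, hl', rfl⟩ := Finset.mem_image.1 hl
      obtain ⟨hn, rfl⟩ := mem_arrangements.1 hl'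
      exact mem_arrangements.2 ⟨hn.map hφ.injective, by ext; simp⟩
    · rw [Finset.card_image_of_injective _ (List.map_injective_iff.2 hφ.injective),
        card_arrangements, card_arrangements, Finset.card_image_of_injective _ hφ.injective]
  rw [himg, Finset.sum_image fun _ _ _ _ h => List.map_injective_iff.2 hφ.injective h]
  refine Finset.sum_congr rfl fun l hl => ?_
  rw [treeOf_map hφ l (mem_arrangements.1 hl).1, BT.countBal_map]

lemma sum_arrangements_countBal (k : ℕ) (S : Finset ℕ) :
    ∑ l ∈ arrangements S, countBal k (treeOf l) = a S.card k := by
  have key : ∀ S : Finset ℕ, ∑ l ∈ arrangements S, countBal k (treeOf l) =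
      ∑ l ∈ arrangements (Finset.range S.card), countBal k (treeOf l) := fun S => by
    obtain ⟨φ, hφ, hS⟩ := exists_strictMono_image_range S
    conv_lhs => rw [← hS]
    exact sum_countBal_image k hφ _
  rw [a_eq_sum_arrangements_range', key, key (List.range' 1 S.card).toFinset,
    List.toFinset_card_of_nodup List.nodup_range', List.length_range']

/-- Once `n + 1` is too large for the root to be balanced of rank `k`, all balanced vertices
of rank `k` lie in the two subtrees of the root. -/
lemma a_succ {n k : ℕ} (hn : 2 ^ (k + 1) ≤ n + 1) :
    a (n + 1) k = ∑ j ∈ Finset.range (n + 1),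
      n.choose j * ((n - j).factorial * a j k + j.factorial * a (n - j) k) := by
  have hins : (insert n (Finset.range n)).card = n + 1 := by simp
  have hsum := Finset.sum_powerset_apply_card (x := Finset.range n)
    (fun j => (n - j).factorial * a j k + j.factorial * a (n - j) k)
  simp only [Finset.card_range, smul_eq_mul] at hsum
  rw [← hsum, ← hins, ← sum_arrangements_countBal,
    sum_arrangements_insert n _ Finset.notMem_range_self]
  refine Finset.sum_congr rfl fun A hA => ?_
  rw [Finset.mem_powerset] at hA
  have hcard : (Finset.range n \ A).card = n - A.card := by
    rw [Finset.card_sdiff_of_subset hA, Finset.card_range]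
  have hterm : ∀ q ∈ arrangements A ×ˢ arrangements (Finset.range n \ A),
      countBal k (treeOf (q.1 ++ n :: q.2)) =
        countBal k (treeOf q.1) + countBal k (treeOf q.2) := by
    rintro ⟨l₁, l₂⟩ hq
    obtain ⟨h₁, h₂⟩ := Finset.mem_product.1 hq
    obtain ⟨n₁, e₁⟩ := mem_arrangements.1 h₁
    obtain ⟨n₂, e₂⟩ := mem_arrangements.1 h₂
    have lt₁ : ∀ x ∈ l₁, x < n := fun x hx => by
      rw [← List.mem_toFinset, e₁] at hx
      exact Finset.mem_range.1 (hA hx)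
    have lt₂ : ∀ x ∈ l₂, x < n := fun x hx => by
      rw [← List.mem_toFinset, e₂] at hx
      exact Finset.mem_range.1 (Finset.mem_sdiff.1 hx).1
    have c₁ : l₁.length = A.card := by rw [← e₁, List.toFinset_card_of_nodup n₁]
    have c₂ : l₂.length = n - A.card := by rw [← hcard, ← e₂, List.toFinset_card_of_nodup n₂]
    dsimp only
    rw [treeOf_split n l₁ l₂ lt₁ lt₂ n₁ n₂, countBal, if_neg, add_zero]
    intro h
    have := BT.size_lt_of_balRank_eq_some h
    rw [BT.size, size_treeOf l₁ n₁, size_treeOf l₂ n₂, c₁, c₂] at this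
    omega
  rw [Finset.sum_congr rfl hterm, Finset.sum_add_distrib, Finset.sum_product,
    Finset.sum_product_right]
  simp only [Finset.sum_const, smul_eq_mul, card_arrangements, hcard]
  rw [← Finset.mul_sum, ← Finset.mul_sum, sum_arrangements_countBal, sum_arrangements_countBal,
    hcard]

lemma succ_mul_a_div_factorial {n k : ℕ} (hn : 2 ^ (k + 1) ≤ n + 1) :
    ((n : ℚ) + 1) * ((a (n + 1) k : ℚ) / (n + 1).factorial) =
      2 * ∑ j ∈ Finset.range (n + 1), (a j k : ℚ) / j.factorial := by
  have hrefl := Finset.sum_range_reflect (fun j => (a j k : ℚ) / j.factorial) (n + 1)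
  rw [two_mul]
  nth_rewrite 1 [← hrefl]
  rw [← Finset.sum_add_distrib, a_succ hn]
  push_cast [Nat.factorial_succ]
  rw [← mul_div_assoc, mul_div_mul_left _ _ (by positivity), Finset.sum_div]
  refine Finset.sum_congr rfl fun j hj => ?_
  have hj : j ≤ n := Nat.lt_succ_iff.1 (Finset.mem_range.1 hj)
  rw [Nat.cast_choose ℚ hj]
  have := Nat.factorial_ne_zero n
  have := Nat.factorial_ne_zero j
  have := Nat.factorial_ne_zero (n - j)
  field_simp
  ring

lemma exists_a_div_factorial_eq (k : ℕ) :
    ∃ c : ℚ, ∀ n, 2 ^ (k + 1) ≤ n → (a n k : ℚ) / n.factorial = c * (n + 1) := by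
  refine ⟨(a (2 ^ (k + 1)) k : ℚ) / (2 ^ (k + 1)).factorial / ((2 ^ (k + 1) : ℕ) + 1),
    fun n hn => ?_⟩
  induction n, hn using Nat.le_induction with
  | base => rw [div_mul_cancel₀ _ (by positivity)]
  | succ n hn ih =>
    obtain ⟨m, rfl⟩ : ∃ m, n = m + 1 := ⟨n - 1, by have := Nat.two_pow_pos (k + 1); omega⟩
    have h₁ := succ_mul_a_div_factorial (k := k) (n := m) hn
    have h₂ := succ_mul_a_div_factorial (k := k) (n := m + 1) (by omega)
    rw [Finset.sum_range_succ, mul_add, ← h₁, ih] at h₂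
    have hne : ((m + 1 : ℕ) : ℚ) + 1 ≠ 0 := by positivity
    apply mul_left_cancel₀ hne
    rw [h₂]
    push_cast
    ring

end BalancedTrees

/-- For every fixed `k ≥ 0` there is a polynomial `P_k` with rational
coefficients such that `(1-x)^2 * ∑_{n≥0} a(n,k) xⁿ/n! = P_k(x)` as formal
power series, and `lim_{n→∞} a(n,k)/(n·n!)` exists and equals `P_k(1)`. -/
theorem statement1 (k : ℕ) :
    ∃ P : Polynomial ℚ,
      (1 - PowerSeries.X) ^ 2 *
          PowerSeries.mk (fun n => (a n k : ℚ) / (Nat.factorial n : ℚ)) =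
        (P : PowerSeries ℚ) ∧
      Filter.Tendsto
        (fun n : ℕ => (a n k : ℝ) / ((n : ℝ) * (Nat.factorial n : ℝ)))
        Filter.atTop (nhds ((P.eval 1 : ℚ) : ℝ)) := by
  obtain ⟨c, hc⟩ := exists_a_div_factorial_eq k
  set A : PowerSeries ℚ := PowerSeries.mk fun n => (a n k : ℚ) / (Nat.factorial n : ℚ) with hA
  set B : PowerSeries ℚ := PowerSeries.mk fun n => (Nat.choose (1 + n) 1 : ℚ) with hB
  have hB1 : B * (1 - PowerSeries.X) ^ 2 = 1 :=
    PowerSeries.mk_add_choose_mul_one_sub_pow_eq_one ℚ 1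
  set q : Polynomial ℚ := PowerSeries.trunc (2 ^ (k + 1)) (A - PowerSeries.C c * B) with hq
  have hAq : A = PowerSeries.C c * B + q := by
    ext n
    rw [map_add, Polynomial.coeff_coe, hq, PowerSeries.coeff_trunc]
    split_ifs with h
    · simp
    · rw [PowerSeries.coeff_C_mul, hA, hB, PowerSeries.coeff_mk, PowerSeries.coeff_mk,
        hc n (not_lt.1 h)]
      push_cast [Nat.choose_one_right]
      ring
  refine ⟨Polynomial.C c + (1 - Polynomial.X) ^ 2 * q, ?_, ?_⟩
  · rw [hAq]
    push_cast
    linear_combination (PowerSeries.C c) * hB1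
  · have heval : (Polynomial.C c + (1 - Polynomial.X) ^ 2 * q).eval 1 = c := by simp
    rw [heval]
    have hlim : Filter.Tendsto (fun n : ℕ => (c : ℝ) * (1 + 1 / (n : ℝ))) Filter.atTop
        (nhds (c : ℝ)) := by
      simpa using (tendsto_one_div_atTop_nhds_zero_nat.const_add (1 : ℝ)).const_mul (c : ℝ)
    refine hlim.congr' ?_
    filter_upwards [Filter.eventually_ge_atTop (2 ^ (k + 1))] with n hn
    have hn0 : (n : ℝ) ≠ 0 := by
      have := Nat.two_pow_pos (k + 1)
      exact_mod_cast (by omega : n ≠ 0)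
    have hcn : (a n k : ℝ) / n.factorial = c * (n + 1) := by
      have := congrArg (fun x : ℚ => (x : ℝ)) (hc n hn)
      push_cast at this
      exact this
    rw [mul_comm (n : ℝ), ← div_div, hcn]
    field_simp
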